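/- Let G be a proper interval graph on {1,…,n} and let λ and C be positive integers. Then G has a [λ,C]-partition if and only if G has a [λ,C]-block partition. -/

import Mathlib

/-- Reachability inside a set `S`: there is a walk from `u` to `v` all of whose
vertices lie in `S`. -/
def ReachIn {α : Type*} (G : SimpleGraph α) (S : Set α) (u v : α) : Prop :=
  Relation.ReflTransGen (fun a b => G.Adj a b ∧ a ∈ S ∧ b ∈ S) u v

/-- The subgraph induced by `S` is connected. -/
def ConnectedIn {α : Type*} (G : SimpleGraph α) (S : Set α) : Prop :=
  ∀ u ∈ S, ∀ v ∈ S, ReachIn G S u v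

/-- `G` is a graph on the vertex set `{1,…,n}`. -/
def OnRange (n : ℕ) (G : SimpleGraph ℕ) : Prop :=
  ∀ u v : ℕ, G.Adj u v → u ∈ Set.Icc 1 n ∧ v ∈ Set.Icc 1 n

/-- The umbrella property characterising proper interval graphs. -/
def Umbrella (G : SimpleGraph ℕ) : Prop :=
  ∀ u v w : ℕ, u < v → v < w → G.Adj u w → G.Adj u v ∧ G.Adj v w

/-- `Ps` is a partition of the vertex set `{1,…,n}`. -/
def IsPartitionOf (n : ℕ) (Ps : Set (Set ℕ)) : Prop :=
  (∀ P ∈ Ps, P.Nonempty) ∧ Ps.PairwiseDisjoint id ∧ ⋃₀ Ps = Set.Icc 1 n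

/-- A `[λ,C]`-partition of the graph `G` on `{1,…,n}`: every part induces a
connected subgraph, every part has at most `C` vertices, and every clique
meets at most `L` parts. -/
def IsLCPartition (n : ℕ) (G : SimpleGraph ℕ) (L C : ℕ) (Ps : Set (Set ℕ)) : Prop :=
  IsPartitionOf n Ps ∧ (∀ P ∈ Ps, ConnectedIn G P ∧ P.ncard ≤ C) ∧
    ∀ K : Set ℕ, G.IsClique K → {P ∈ Ps | (P ∩ K).Nonempty}.ncard ≤ L

/-- A block: a set of consecutive vertices `{u, u+1, …, v}` with `1 ≤ u ≤ v`. -/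
def IsBlockSet (P : Set ℕ) : Prop := ∃ u v : ℕ, 1 ≤ u ∧ u ≤ v ∧ P = Set.Icc u v

/-- A `[λ,C]`-block partition: a `[λ,C]`-partition all of whose parts are blocks. -/
def IsLCBlockPartition (n : ℕ) (G : SimpleGraph ℕ) (L C : ℕ) (Ps : Set (Set ℕ)) : Prop :=
  IsLCPartition n G L C Ps ∧ ∀ P ∈ Ps, IsBlockSet P

/-- A `[λ,C]`-coloring of the graph `G` on `{1,…,n}` with colors `Fin L`:
every monochromatic component has at most `C` vertices. -/
def IsLCColoring (n : ℕ) (G : SimpleGraph ℕ) (C : ℕ) {L : ℕ} (c : ℕ → Fin L) : Prop :=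
  ∀ v ∈ Set.Icc 1 n, {u | ReachIn G {w | c w = c v} v u}.ncard ≤ C

/-- The clique number of `G`. -/
noncomputable def cliqueNumber (G : SimpleGraph ℕ) : ℕ :=
  sSup {m | ∃ s : Finset ℕ, G.IsNClique m s}

/-- The graph `G` on `{1,…,n}` is connected. -/
def ConnectedOn (n : ℕ) (G : SimpleGraph ℕ) : Prop :=
  ConnectedIn G (Set.Icc 1 n)


section Colorings

variable {α : Type*}

/-- The convex hull of the vertices of `D` with color `c` meets the window `[x, y]`. For
`x = y + 1` this says that the hull contains both `y` and `y + 1`. -/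
def HullMeets (D : Finset ℕ) (f : ℕ → α) (c : α) (x y : ℕ) : Prop :=
  ∃ a ∈ D, ∃ b ∈ D, f a = c ∧ f b = c ∧ a ≤ y ∧ x ≤ b

open Classical in
/-- The colors whose hull meets the window `[x, y]`. -/
noncomputable def hullColors (D : Finset ℕ) (f : ℕ → α) (x y : ℕ) : Finset α :=
  (D.image f).filter fun c => HullMeets D f c x y

theorem mem_hullColors {D : Finset ℕ} {f : ℕ → α} {c : α} {x y : ℕ} :
    c ∈ hullColors D f x y ↔ HullMeets D f c x y := by
  classical
  simp only [hullColors, Finset.mem_filter, Finset.mem_image, and_iff_right_iff_imp]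
  rintro ⟨a, ha, b, hb, rfl, -⟩
  exact ⟨a, ha, rfl⟩

theorem card_le_card_of_exchange {A B : Finset α} {p q : α} (hpq : p ≠ q)
    (hother : ∀ c, c ≠ p → c ≠ q → c ∈ A → c ∈ B)
    (hor : p ∈ A ∨ q ∈ A → p ∈ B ∨ q ∈ B) (hand : p ∈ A → q ∈ A → p ∈ B ∧ q ∈ B) :
    A.card ≤ B.card := by
  classical
  by_cases hAB : A ⊆ B
  · exact Finset.card_le_card hAB
  obtain ⟨c, hcA, hcB⟩ := Finset.not_subset.1 hAB
  have key : ∃ d ∈ B, A.erase c ⊆ B.erase d := by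
    have hc : c = p ∨ c = q := by
      by_contra! h
      exact hcB (hother c h.1 h.2 hcA)
    rcases hc with rfl | rfl
    · have hqA : q ∉ A := fun h => hcB (hand hcA h).1
      refine ⟨q, (hor (.inl hcA)).resolve_left hcB, fun d hd => ?_⟩
      rw [Finset.mem_erase] at hd ⊢
      have hdq : d ≠ q := fun h => hqA (h ▸ hd.2)
      exact ⟨hdq, hother d hd.1 hdq hd.2⟩
    · have hpA : p ∉ A := fun h => hcB (hand h hcA).2
      refine ⟨p, (hor (.inr hcA)).resolve_right hcB, fun d hd => ?_⟩
      rw [Finset.mem_erase] at hd ⊢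
      have hdp : d ≠ p := fun h => hpA (h ▸ hd.2)
      exact ⟨hdp, hother d hdp hd.1 hd.2⟩
  obtain ⟨d, hdB, hsub⟩ := key
  have h := Finset.card_le_card hsub
  have hA := Finset.card_erase_add_one hcA
  have hB := Finset.card_erase_add_one hdB
  omega

/-- A threshold splitting `P ∪ Q` into two sets of size at most `C`, lying between the larger
of the two minima and the smaller of the two maxima. -/
theorem exists_balanced_threshold {P Q : Finset ℕ} {C k : ℕ} (hP : P.card ≤ C)
    (hQ : Q.card ≤ C) (hPl : ∃ a ∈ P, a ≤ k) (hPr : ∃ b ∈ P, k ≤ b)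
    (hQl : ∃ a ∈ Q, a ≤ k) (hQr : ∃ b ∈ Q, k ≤ b) :
    ∃ t, ((P ∪ Q).filter (· < t)).card ≤ C ∧ ((P ∪ Q).filter (t ≤ ·)).card ≤ C ∧
      (∃ a ∈ P, a ≤ t) ∧ (∃ a ∈ Q, a ≤ t) ∧
      (∀ a < t, ∃ b ∈ P, a ≤ b) ∧ (∀ a < t, ∃ b ∈ Q, a ≤ b) := by
  have hPne : P.Nonempty := hPl.imp fun _ h => h.1
  have hQne : Q.Nonempty := hQl.imp fun _ h => h.1
  obtain ⟨a₁, ha₁, ha₁k⟩ := hPl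
  obtain ⟨b₁, hb₁, hb₁k⟩ := hPr
  obtain ⟨a₂, ha₂, ha₂k⟩ := hQl
  obtain ⟨b₂, hb₂, hb₂k⟩ := hQr
  have hlp := P.min'_le a₁ ha₁
  have hlq := Q.min'_le a₂ ha₂
  have hrp := P.le_max' b₁ hb₁
  have hrq := Q.le_max' b₂ hb₂
  set l := max (P.min' hPne) (Q.min' hQne) with hl
  set r := min (P.max' hPne) (Q.max' hQne) with hr
  have hlr : l ≤ r := by omega
  have hlow : ((P ∪ Q).filter (· < l)).card ≤ C := by
    rcases le_total (P.min' hPne) (Q.min' hQne) with h | h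
    · refine (Finset.card_le_card fun v hv => ?_).trans hP
      simp only [Finset.mem_filter, Finset.mem_union] at hv
      refine hv.1.resolve_right fun hvQ => ?_
      have := Q.min'_le v hvQ
      omega
    · refine (Finset.card_le_card fun v hv => ?_).trans hQ
      simp only [Finset.mem_filter, Finset.mem_union] at hv
      refine hv.1.resolve_left fun hvP => ?_
      have := P.min'_le v hvP
      omega
  have hhigh : ((P ∪ Q).filter (r + 1 ≤ ·)).card ≤ C := by
    rcases le_total (P.max' hPne) (Q.max' hQne) with h | h
    · refine (Finset.card_le_card fun v hv => ?_).trans hQ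
      simp only [Finset.mem_filter, Finset.mem_union] at hv
      refine hv.1.resolve_left fun hvP => ?_
      have := P.le_max' v hvP
      omega
    · refine (Finset.card_le_card fun v hv => ?_).trans hP
      simp only [Finset.mem_filter, Finset.mem_union] at hv
      refine hv.1.resolve_right fun hvQ => ?_
      have := Q.le_max' v hvQ
      omega
  have hsplit : ∀ t, ((P ∪ Q).filter (· < t)).card + ((P ∪ Q).filter (t ≤ ·)).card ≤ 2 * C := by
    intro t
    have h := Finset.card_filter_add_card_filter_not (s := P ∪ Q) (· < t)
    simp only [not_lt] at h
    have := Finset.card_union_le P Q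
    omega
  have hstep : ∀ t, ((P ∪ Q).filter (· < t + 1)).card ≤ ((P ∪ Q).filter (· < t)).card + 1 := by
    intro t
    refine (Finset.card_le_card fun v hv => ?_).trans
      (Finset.card_insert_le t ((P ∪ Q).filter (· < t)))
    simp only [Finset.mem_filter, Finset.mem_insert] at hv ⊢
    by_cases hvt : v = t
    · exact .inl hvt
    · exact .inr ⟨hv.1, by omega⟩
  have hex : ∃ t, l ≤ t ∧ t ≤ r + 1 ∧ ((P ∪ Q).filter (· < t)).card ≤ C ∧
      ((P ∪ Q).filter (t ≤ ·)).card ≤ C := by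
    set t := Nat.findGreatest
      (fun t => l ≤ t ∧ ((P ∪ Q).filter (· < t)).card ≤ C) (r + 1) with ht
    have hspec : l ≤ t ∧ ((P ∪ Q).filter (· < t)).card ≤ C :=
      Nat.findGreatest_spec (P := fun t => l ≤ t ∧ ((P ∪ Q).filter (· < t)).card ≤ C)
        (by omega : l ≤ r + 1) ⟨le_rfl, hlow⟩
    have htr : t ≤ r + 1 := Nat.findGreatest_le _
    refine ⟨t, hspec.1, htr, hspec.2, ?_⟩
    rcases htr.eq_or_lt with h | h
    · rw [h]
      exact hhigh
    · have hnot := Nat.findGreatest_is_greatest (lt_add_one t) h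
      have h1 := hstep t
      have h2 := hsplit t
      have h3 : ¬ ((P ∪ Q).filter (· < t + 1)).card ≤ C := fun h3 => hnot ⟨by omega, h3⟩
      omega
  obtain ⟨t, hlt, htr, h1, h2⟩ := hex
  exact ⟨t, h1, h2, ⟨_, P.min'_mem hPne, by omega⟩, ⟨_, Q.min'_mem hQne, by omega⟩,
    fun a ha => ⟨_, P.max'_mem hPne, by omega⟩, fun a ha => ⟨_, Q.max'_mem hQne, by omega⟩⟩

/-- Two color classes with intersecting hulls can be recolored so that their hulls become
disjoint, without increasing the number of hulls meeting any window. -/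
theorem exists_uncrossing {D : Finset ℕ} {f : ℕ → α} {C k : ℕ} {p q : α} (hpq : p ≠ q)
    (hC : ∀ c, {v | v ∈ D ∧ f v = c}.ncard ≤ C)
    (hp : HullMeets D f p k k) (hq : HullMeets D f q k k) :
    ∃ g : ℕ → α, (∀ c, {v | v ∈ D ∧ g v = c}.ncard ≤ C) ∧
      (∀ x y, x ≤ y + 1 → (hullColors D g x y).card ≤ (hullColors D f x y).card) ∧
      (hullColors D g k k).card < (hullColors D f k k).card := by
  classical
  have hcoe : ∀ c, {v | v ∈ D ∧ f v = c} = ((D.filter (f · = c) : Finset ℕ) : Set ℕ) := by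
    intro c; ext; simp
  have hC' : ∀ c, (D.filter (f · = c)).card ≤ C := by
    intro c
    have := hC c
    rwa [hcoe, Set.ncard_coe_finset] at this
  obtain ⟨a₁, ha₁, b₁, hb₁, fa₁, fb₁, ha₁k, hb₁k⟩ := hp
  obtain ⟨a₂, ha₂, b₂, hb₂, fa₂, fb₂, ha₂k, hb₂k⟩ := hq
  obtain ⟨t, hlo, hhi, hPt, hQt, hPa, hQa⟩ :=
    exists_balanced_threshold (P := D.filter (f · = p)) (Q := D.filter (f · = q)) (k := k)
      (hC' p) (hC' q) ⟨a₁, by simp [*], ha₁k⟩ ⟨b₁, by simp [*], hb₁k⟩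
      ⟨a₂, by simp [*], ha₂k⟩ ⟨b₂, by simp [*], hb₂k⟩
  obtain ⟨s₁, hs₁, hs₁t⟩ := hPt
  obtain ⟨s₂, hs₂, hs₂t⟩ := hQt
  simp only [Finset.mem_filter] at hs₁ hs₂ hPa hQa
  let g : ℕ → α := fun v => if f v = p ∨ f v = q then (if v < t then p else q) else f v
  have hgp : ∀ v, g v = p ↔ (f v = p ∨ f v = q) ∧ v < t := by
    intro v; simp only [g]; split_ifs <;> grind
  have hgq : ∀ v, g v = q ↔ (f v = p ∨ f v = q) ∧ t ≤ v := by
    intro v; simp only [g]; split_ifs <;> grind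
  have hgo : ∀ c, c ≠ p → c ≠ q → ∀ v, g v = c ↔ f v = c := by
    intro c h1 h2 v; simp only [g]; split_ifs <;> grind
  have hother : ∀ x y c, c ≠ p → c ≠ q → c ∈ hullColors D g x y → c ∈ hullColors D f x y := by
    intro x y c h1 h2 h
    simpa only [mem_hullColors, HullMeets, hgo c h1 h2] using h
  have hand : ∀ x y, p ∈ hullColors D g x y → q ∈ hullColors D g x y →
      p ∈ hullColors D f x y ∧ q ∈ hullColors D f x y := by
    intro x y h1 h2
    rw [mem_hullColors] at h1 h2 ⊢
    rw [mem_hullColors]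
    obtain ⟨-, -, b, -, -, hgb, -, hxb⟩ := h1
    obtain ⟨a, -, -, -, hga, -, hay, -⟩ := h2
    obtain ⟨-, hbt⟩ := (hgp b).1 hgb
    obtain ⟨-, hta⟩ := (hgq a).1 hga
    obtain ⟨u, hu, hbu⟩ := hPa b hbt
    obtain ⟨w, hw, hbw⟩ := hQa b hbt
    exact ⟨⟨s₁, hs₁.1, u, hu.1, hs₁.2, hu.2, by omega, by omega⟩,
      ⟨s₂, hs₂.1, w, hw.1, hs₂.2, hw.2, by omega, by omega⟩⟩
  have hor : ∀ x y, x ≤ y + 1 → p ∈ hullColors D g x y ∨ q ∈ hullColors D g x y →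
      p ∈ hullColors D f x y ∨ q ∈ hullColors D f x y := by
    intro x y hxy h
    simp only [mem_hullColors] at h ⊢
    have h' : ∃ a ∈ D, ∃ b ∈ D, (f a = p ∨ f a = q) ∧ (f b = p ∨ f b = q) ∧ a ≤ y ∧ x ≤ b := by
      rcases h with ⟨a, ha, b, hb, hga, hgb, hay, hxb⟩ | ⟨a, ha, b, hb, hga, hgb, hay, hxb⟩
      · exact ⟨a, ha, b, hb, ((hgp a).1 hga).1, ((hgp b).1 hgb).1, hay, hxb⟩
      · exact ⟨a, ha, b, hb, ((hgq a).1 hga).1, ((hgq b).1 hgb).1, hay, hxb⟩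
    obtain ⟨a, ha, b, hb, hfa, hfb, hay, hxb⟩ := h'
    rcases hfa with hfa | hfa <;> rcases hfb with hfb | hfb
    · exact .inl ⟨a, ha, b, hb, hfa, hfb, hay, hxb⟩
    · by_cases hk : x ≤ k
      · exact .inl ⟨a, ha, b₁, hb₁, hfa, fb₁, hay, by omega⟩
      · exact .inr ⟨a₂, ha₂, b, hb, fa₂, hfb, by omega, hxb⟩
    · by_cases hk : x ≤ k
      · exact .inr ⟨a, ha, b₂, hb₂, hfa, fb₂, hay, by omega⟩
      · exact .inl ⟨a₁, ha₁, b, hb, fa₁, hfb, by omega, hxb⟩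
    · exact .inr ⟨a, ha, b, hb, hfa, hfb, hay, hxb⟩
  refine ⟨g, fun c => ?_, fun x y hxy => card_le_card_of_exchange hpq (hother x y)
    (hor x y hxy) (hand x y), ?_⟩
  · by_cases hcp : c = p
    · subst hcp
      rw [← Set.ncard_coe_finset] at hlo
      refine (Set.ncard_le_ncard (fun v hv => ?_) (Finset.finite_toSet _)).trans hlo
      have := (hgp v).1 hv.2
      have := hv.1
      simp only [Finset.coe_filter, Finset.mem_union, Finset.mem_filter, Set.mem_ofPred_eq]
      tauto
    · by_cases hcq : c = q
      · subst hcq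
        rw [← Set.ncard_coe_finset] at hhi
        refine (Set.ncard_le_ncard (fun v hv => ?_) (Finset.finite_toSet _)).trans hhi
        have := (hgq v).1 hv.2
        have := hv.1
        simp only [Finset.coe_filter, Finset.mem_union, Finset.mem_filter, Set.mem_ofPred_eq]
        tauto
      · simpa only [hgo c hcp hcq] using hC c
  · have hpf : p ∈ hullColors D f k k :=
      mem_hullColors.2 ⟨a₁, ha₁, b₁, hb₁, fa₁, fb₁, ha₁k, hb₁k⟩
    have hqf : q ∈ hullColors D f k k :=
      mem_hullColors.2 ⟨a₂, ha₂, b₂, hb₂, fa₂, fb₂, ha₂k, hb₂k⟩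
    have hnot : ¬ (p ∈ hullColors D g k k ∧ q ∈ hullColors D g k k) := by
      rintro ⟨h1, h2⟩
      rw [mem_hullColors] at h1 h2
      obtain ⟨-, -, b, -, -, hgb, -, hkb⟩ := h1
      obtain ⟨a, -, -, -, hga, -, hak, -⟩ := h2
      have := ((hgp b).1 hgb).2
      have := ((hgq a).1 hga).2
      omega
    refine Finset.card_lt_card (Finset.ssubset_iff_subset_ne.2 ⟨fun c hc => ?_, fun h => ?_⟩)
    · by_cases hcp : c = p
      · exact hcp ▸ hpf
      · by_cases hcq : c = q
        · exact hcq ▸ hqf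
        · exact hother k k c hcp hcq hc
    · exact hnot ⟨h ▸ hpf, h ▸ hqf⟩

/-- Every coloring can be transformed into one whose classes have pairwise disjoint hulls,
without increasing the number of hulls meeting any window. -/
theorem exists_disjoint_hulls (D : Finset ℕ) (C : ℕ) (f : ℕ → α)
    (hC : ∀ c, {v | v ∈ D ∧ f v = c}.ncard ≤ C) :
    ∃ g : ℕ → α, (∀ c, {v | v ∈ D ∧ g v = c}.ncard ≤ C) ∧
      (∀ x y, x ≤ y + 1 → (hullColors D g x y).card ≤ (hullColors D f x y).card) ∧
      ∀ p q k, HullMeets D g p k k → HullMeets D g q k k → p = q := by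
  induction hm : ∑ k ∈ Finset.range (D.sup id + 1), (hullColors D f k k).card
    using Nat.strong_induction_on generalizing f with
  | _ m ih =>
    by_cases h : ∀ p q k, HullMeets D f p k k → HullMeets D f q k k → p = q
    · exact ⟨f, hC, fun _ _ _ => le_rfl, h⟩
    push Not at h
    obtain ⟨p, q, k, hp, hq, hpq⟩ := h
    obtain ⟨g, hgC, hg, hlt⟩ := exists_uncrossing hpq hC hp hq
    have hk : k ∈ Finset.range (D.sup id + 1) := by
      obtain ⟨-, -, b, hb, -, -, -, hkb⟩ := hp
      have : b ≤ D.sup id := Finset.le_sup (f := id) hb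
      simp only [Finset.mem_range]
      omega
    obtain ⟨g', hg'C, hg', hdisj⟩ := ih _
      (hm ▸ Finset.sum_lt_sum (fun x _ => hg x x (by omega)) ⟨k, hk, hlt⟩) g hgC rfl
    exact ⟨g', hg'C, fun x y hxy => (hg' x y hxy).trans (hg x y hxy), hdisj⟩

end Colorings

theorem Umbrella.isClique_Icc {G : SimpleGraph ℕ} (humb : Umbrella G) {a b : ℕ}
    (hab : a = b ∨ G.Adj a b) : G.IsClique (Set.Icc a b) := by
  have key : ∀ u v, a ≤ u → u < v → v ≤ b → G.Adj u v := by
    intro u v hau huv hvb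
    have h : G.Adj a b := hab.resolve_left (by omega)
    have hav : G.Adj a v := by
      rcases hvb.eq_or_lt with rfl | hvb
      · exact h
      · exact (humb a v b (by omega) hvb h).1
    rcases hau.eq_or_lt with rfl | hau
    · exact hav
    · exact (humb a u v hau huv hav).2
  intro u hu v hv huv
  rcases lt_or_gt_of_ne huv with h | h
  · exact key u v hu.1 h hv.2
  · exact (key v u hv.1 h hu.2).symm

/-- A connected set with vertices on both sides of a window that it avoids has an edge jumping
over the window. -/
theorem ConnectedIn.exists_adj_over {G : SimpleGraph ℕ} {S : Set ℕ} (hS : ConnectedIn G S)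
    {x y u v : ℕ} (havoid : ∀ w ∈ S, x ≤ w → y < w) (hu : u ∈ S) (hv : v ∈ S)
    (hux : u < x) (hxv : x ≤ v) : ∃ a ∈ S, ∃ b ∈ S, G.Adj a b ∧ a < x ∧ y < b := by
  have h : ReachIn G S u v := hS u hu v hv
  unfold ReachIn at h
  induction h using Relation.ReflTransGen.head_induction_on with
  | refl => omega
  | @head a b hab _ ih =>
    by_cases hb : b < x
    · exact ih hab.2.2 hb
    · exact ⟨a, hab.2.1, b, hab.2.2, hab.1, hux, havoid b hab.2.2 (by omega)⟩

/-- A Helly property: some clique meets every connected set whose hull meets a given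
clique window. -/
theorem Umbrella.exists_clique_meeting_hulls {G : SimpleGraph ℕ} (humb : Umbrella G) {x y : ℕ}
    (hxy : x ≤ y) (h : x = y ∨ G.Adj x y) :
    ∃ K : Set ℕ, G.IsClique K ∧ ∀ S : Set ℕ, ConnectedIn G S →
      (∃ a ∈ S, ∃ b ∈ S, a ≤ y ∧ x ≤ b) → (S ∩ K).Nonempty := by
  classical
  by_cases hj : ∃ a, a < x ∧ ∃ b, y < b ∧ G.Adj a b
  · obtain ⟨hax, b, hyb, hab⟩ := Nat.find_spec hj
    refine ⟨Set.Icc (Nat.find hj) b, humb.isClique_Icc (.inr hab), ?_⟩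
    rintro S hS ⟨u, hu, v, hv, huy, hxv⟩
    by_cases hmeet : ∃ w ∈ S, x ≤ w ∧ w ≤ y
    · obtain ⟨w, hw, h1, h2⟩ := hmeet
      exact ⟨w, hw, by omega, by omega⟩
    push Not at hmeet
    have hux : u < x := by
      by_contra hux
      have := hmeet u hu (by omega)
      omega
    obtain ⟨a', ha', b', -, hadj, h1, h2⟩ := hS.exists_adj_over hmeet hu hv hux hxv
    exact ⟨a', ha', Nat.find_min' hj ⟨h1, b', h2, hadj⟩, by omega⟩
  · refine ⟨Set.Icc x y, humb.isClique_Icc h, ?_⟩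
    rintro S hS ⟨u, hu, v, hv, huy, hxv⟩
    by_contra hmeet
    have havoid : ∀ w ∈ S, x ≤ w → y < w := by
      intro w hw h1
      by_contra h2
      exact hmeet ⟨w, hw, h1, by omega⟩
    have hux : u < x := by
      by_contra hux
      have := havoid u hu (by omega)
      omega
    obtain ⟨a', -, b', -, hadj, h1, h2⟩ := hS.exists_adj_over havoid hu hv hux hxv
    exact hj ⟨a', h1, b', h2, hadj⟩

theorem connectedIn_of_adj_succ {G : SimpleGraph ℕ} {S : Set ℕ}
    (hconv : ∀ u ∈ S, ∀ v ∈ S, ∀ w, u ≤ w → w ≤ v → w ∈ S)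
    (hadj : ∀ k, k ∈ S → k + 1 ∈ S → G.Adj k (k + 1)) : ConnectedIn G S := by
  have key : ∀ u ∈ S, ∀ v, u ≤ v → v ∈ S → ReachIn G S u v ∧ ReachIn G S v u := by
    intro u hu v huv
    induction v, huv using Nat.le_induction with
    | base => exact fun _ => ⟨.refl, .refl⟩
    | succ v huv ih =>
      intro hv1
      have hv : v ∈ S := hconv u hu (v + 1) hv1 v huv (by omega)
      obtain ⟨h1, h2⟩ := ih hv
      exact ⟨h1.tail ⟨hadj v hv hv1, hv, hv1⟩, .head ⟨(hadj v hv hv1).symm, hv1, hv⟩ h2⟩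
  intro u hu v hv
  rcases le_total u v with h | h
  · exact (key u hu v h hv).1
  · exact (key v hv u h hu).2

/-- A coloring of `{1,…,n}` with disjoint hulls that meet few clique windows yields a block
partition. -/
theorem isLCBlockPartition_of_coloring {α : Type*} {n : ℕ} {G : SimpleGraph ℕ} {L C : ℕ}
    (g : ℕ → α)
    (hC : ∀ c, {v | v ∈ Finset.Icc 1 n ∧ g v = c}.ncard ≤ C)
    (hL : ∀ x y, x ≤ y → (x = y ∨ G.Adj x y) → (hullColors (Finset.Icc 1 n) g x y).card ≤ L)
    (hadj : ∀ k, (hullColors (Finset.Icc 1 n) g (k + 1) k).Nonempty → G.Adj k (k + 1))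
    (hdisj : ∀ p q k, HullMeets (Finset.Icc 1 n) g p k k →
      HullMeets (Finset.Icc 1 n) g q k k → p = q) :
    IsLCBlockPartition n G L C
      ((fun c => {v | v ∈ Finset.Icc 1 n ∧ g v = c}) '' (g '' Set.Icc 1 n)) := by
  have hconv : ∀ c, ∀ u ∈ {v | v ∈ Finset.Icc 1 n ∧ g v = c},
      ∀ v ∈ {v | v ∈ Finset.Icc 1 n ∧ g v = c}, ∀ w, u ≤ w → w ≤ v →
      w ∈ {v | v ∈ Finset.Icc 1 n ∧ g v = c} := by
    rintro c u ⟨hu, hgu⟩ v ⟨hv, hgv⟩ w huw hwv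
    have hw : w ∈ Finset.Icc 1 n := by
      rw [Finset.mem_Icc] at *
      omega
    exact ⟨hw, hdisj _ _ w ⟨w, hw, w, hw, rfl, rfl, le_rfl, le_rfl⟩
      ⟨u, hu, v, hv, hgu, hgv, huw, hwv⟩⟩
  refine ⟨⟨⟨?_, ?_, ?_⟩, ?_, ?_⟩, ?_⟩
  · rintro _ ⟨_, ⟨v, hv, rfl⟩, rfl⟩
    exact ⟨v, by simpa using hv, rfl⟩
  · rintro _ ⟨c, -, rfl⟩ _ ⟨d, -, rfl⟩ hne
    refine Set.disjoint_left.2 ?_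
    rintro v ⟨-, h1⟩ ⟨-, h2⟩
    exact hne (by rw [← h1, ← h2])
  · ext v
    constructor
    · rintro ⟨_, ⟨c, -, rfl⟩, hv, -⟩
      simpa using hv
    · intro hv
      exact ⟨_, ⟨_, ⟨v, hv, rfl⟩, rfl⟩, by simpa using hv, rfl⟩
  · rintro _ ⟨c, -, rfl⟩
    refine ⟨connectedIn_of_adj_succ (hconv c) ?_, hC c⟩
    rintro k ⟨hk, hgk⟩ ⟨hk1, hgk1⟩
    exact hadj k ⟨c, mem_hullColors.2 ⟨k, hk, k + 1, hk1, hgk, hgk1, le_rfl, le_rfl⟩⟩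
  · intro K hK
    classical
    by_cases hne : ((Finset.Icc 1 n).filter (· ∈ K)).Nonempty
    · set T := (Finset.Icc 1 n).filter (· ∈ K) with hT
      have hxy : T.min' hne ≤ T.max' hne := T.min'_le _ (T.max'_mem hne)
      have hx := T.min'_mem hne
      have hy := T.max'_mem hne
      have hcl : T.min' hne = T.max' hne ∨ G.Adj (T.min' hne) (T.max' hne) := by
        by_cases h : T.min' hne = T.max' hne
        · exact .inl h
        · exact .inr (hK (Finset.mem_filter.1 hx).2 (Finset.mem_filter.1 hy).2 h)
      refine le_trans ?_ (hL _ _ hxy hcl)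
      rw [← Set.ncard_coe_finset]
      refine (Set.ncard_le_ncard ?_ ((Finset.finite_toSet _).image
        (fun c => {v | v ∈ Finset.Icc 1 n ∧ g v = c}))).trans
        (Set.ncard_image_le (Finset.finite_toSet _))
      rintro _ ⟨⟨c, -, rfl⟩, v, ⟨hv, hgv⟩, hvK⟩
      have hvT : v ∈ T := Finset.mem_filter.2 ⟨hv, hvK⟩
      exact ⟨c, mem_hullColors.2 ⟨v, hv, v, hv, hgv, hgv, T.le_max' v hvT, T.min'_le v hvT⟩, rfl⟩
    · have hempty : {P ∈ (fun c => {v | v ∈ Finset.Icc 1 n ∧ g v = c}) '' (g '' Set.Icc 1 n) |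
          (P ∩ K).Nonempty} = ∅ := by
        refine Set.eq_empty_of_forall_notMem ?_
        rintro _ ⟨⟨c, -, rfl⟩, v, ⟨hv, -⟩, hvK⟩
        exact hne ⟨v, Finset.mem_filter.2 ⟨hv, hvK⟩⟩
      rw [hempty, Set.ncard_empty]
      exact Nat.zero_le L
  · rintro _ ⟨_, ⟨w, hw, rfl⟩, rfl⟩
    classical
    set T := (Finset.Icc 1 n).filter (g · = g w) with hT
    have hmem : ∀ v, v ∈ T ↔ v ∈ {v | v ∈ Finset.Icc 1 n ∧ g v = g w} := by simp [hT]
    have hne : T.Nonempty := ⟨w, by simpa [hT] using hw⟩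
    have hx := (hmem _).1 (T.min'_mem hne)
    have hy := (hmem _).1 (T.max'_mem hne)
    refine ⟨T.min' hne, T.max' hne, (Finset.mem_Icc.1 hx.1).1,
      T.min'_le _ (T.max'_mem hne), Set.ext fun v => ⟨fun hv => ?_, fun hv => ?_⟩⟩
    · exact ⟨T.min'_le v ((hmem v).2 hv), T.le_max' v ((hmem v).2 hv)⟩
    · exact hconv _ _ hx _ hy v hv.1 hv.2

theorem IsLCPartition.exists_blockPartition {n : ℕ} {G : SimpleGraph ℕ} {L C : ℕ}
    {Ps : Set (Set ℕ)} (humb : Umbrella G)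
    (hPs : IsLCPartition n G L C Ps) : ∃ Qs : Set (Set ℕ), IsLCBlockPartition n G L C Qs := by
  obtain ⟨⟨-, hdisj, hunion⟩, hparts, hcliques⟩ := hPs
  have hcover : ∀ v, ∃ P : Set ℕ, v ∈ Finset.Icc 1 n → P ∈ Ps ∧ v ∈ P := by
    intro v
    by_cases hv : v ∈ Finset.Icc 1 n
    · have : v ∈ ⋃₀ Ps := by rw [hunion]; simpa using hv
      obtain ⟨P, hP, hvP⟩ := this
      exact ⟨P, fun _ => ⟨hP, hvP⟩⟩
    · exact ⟨∅, fun h => absurd h hv⟩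
  choose f hf using hcover
  have hsub : ∀ P ∈ Ps, P ⊆ Set.Icc 1 n := fun P hP => hunion ▸ Set.subset_sUnion_of_mem hP
  have hfin : Ps.Finite := (Set.finite_Icc 1 n).finite_subsets.subset hsub
  have hfC : ∀ P, {v | v ∈ Finset.Icc 1 n ∧ f v = P}.ncard ≤ C := by
    intro P
    by_cases hP : P ∈ Ps
    · refine (Set.ncard_le_ncard ?_ ((Set.finite_Icc 1 n).subset (hsub P hP))).trans
        (hparts P hP).2
      rintro v ⟨hv, rfl⟩
      exact (hf v hv).2
    · have : {v | v ∈ Finset.Icc 1 n ∧ f v = P} = ∅ := by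
        refine Set.eq_empty_of_forall_notMem ?_
        rintro v ⟨hv, rfl⟩
        exact hP (hf v hv).1
      rw [this, Set.ncard_empty]
      exact Nat.zero_le C
  have hhull : ∀ P x y, HullMeets (Finset.Icc 1 n) f P x y →
      P ∈ Ps ∧ ∃ a ∈ P, ∃ b ∈ P, a ≤ y ∧ x ≤ b := by
    rintro P x y ⟨a, ha, b, hb, rfl, hfb, hay, hxb⟩
    exact ⟨(hf a ha).1, a, (hf a ha).2, b, hfb ▸ (hf b hb).2, hay, hxb⟩
  obtain ⟨g, hgC, hg, hgdisj⟩ := exists_disjoint_hulls (Finset.Icc 1 n) C f hfC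
  refine ⟨_, isLCBlockPartition_of_coloring g hgC ?_ ?_ hgdisj⟩
  · intro x y hxy h
    refine (hg x y (by omega)).trans ?_
    obtain ⟨K, hK, hmeet⟩ := humb.exists_clique_meeting_hulls hxy h
    refine le_trans ?_ (hcliques K hK)
    rw [← Set.ncard_coe_finset]
    refine Set.ncard_le_ncard (fun P hP => ?_) (hfin.subset fun P hP => hP.1)
    obtain ⟨hPs, hab⟩ := hhull P x y (mem_hullColors.1 hP)
    exact ⟨hPs, hmeet P (hparts P hPs).1 hab⟩
  · intro k hk
    have hpos := (Finset.card_pos.2 hk).trans_le (hg (k + 1) k le_rfl)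
    obtain ⟨P, hP⟩ := Finset.card_pos.1 hpos
    obtain ⟨hPs, a, ha, b, hb, hak, hkb⟩ := hhull P _ _ (mem_hullColors.1 hP)
    obtain ⟨u, -, v, -, huv, huk, hkv⟩ := (hparts P hPs).1.exists_adj_over
      (x := k + 1) (y := k) (fun w _ h => h) ha hb (by omega) hkb
    exact humb.isClique_Icc (.inr huv) ⟨by omega, by omega⟩ ⟨by omega, by omega⟩ (by omega)

/-- a proper interval graph has a `[λ,C]`-partition iff it has a
`[λ,C]`-block partition. -/
theorem partition_iff_blockPartition (n : ℕ) (G : SimpleGraph ℕ)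
    (hrange : OnRange n G) (humb : Umbrella G) (L C : ℕ) (hL : 0 < L) (hC : 0 < C) :
    (∃ Ps : Set (Set ℕ), IsLCPartition n G L C Ps) ↔
      (∃ Ps : Set (Set ℕ), IsLCBlockPartition n G L C Ps) := by
  exact ⟨fun ⟨_, hPs⟩ => hPs.exists_blockPartition humb, fun ⟨Qs, hQs⟩ => ⟨Qs, hQs.1⟩⟩
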